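/- The non-alternating five term element satisfies FT⁺[x,y] = FT[−x, y+1] + 2c in the pre-Bloch group, where FT⁺[x,y] = [−x]+[−y]+[−(1+y)/x]+[−(1+x+y)/(xy)]+[−(1+x)/y], FT is the alternating five term element, and c = [w]+[1−w]; concretely, as elements of ℤ[F\{0,1\}] modulo five term relations, FT⁺[x,y] − FT[−x,y+1] = [w]+[1−w]+[w']+[1−w'] for appropriate arguments. -/

import Mathlib

/-- The alternating five term element
`FT[x,y] = [x] - [y] + [y/x] - [(1-x⁻¹)/(1-y⁻¹)] + [(1-x)/(1-y)] ∈ ℤ[F]`. -/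
def FT {F : Type*} [Field F] (x y : F) : FreeAbelianGroup F :=
  FreeAbelianGroup.of x - FreeAbelianGroup.of y + FreeAbelianGroup.of (y / x)
    - FreeAbelianGroup.of ((1 - x⁻¹) / (1 - y⁻¹)) + FreeAbelianGroup.of ((1 - x) / (1 - y))

/-- The non-alternating five term element
`FT⁺[x,y] = [-x] + [-y] + [-(1+y)/x] + [-(1+x+y)/(xy)] + [-(1+x)/y]`. -/
def FTplus {F : Type*} [Field F] (x y : F) : FreeAbelianGroup F :=
  FreeAbelianGroup.of (-x) + FreeAbelianGroup.of (-y) + FreeAbelianGroup.of (-(1 + y) / x)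
    + FreeAbelianGroup.of (-(1 + x + y) / (x * y)) + FreeAbelianGroup.of (-(1 + x) / y)

/-- The subgroup of five term relations (with generic arguments in `F \ {0,1}`). -/
def FTsub (F : Type*) [Field F] : AddSubgroup (FreeAbelianGroup F) :=
  AddSubgroup.closure
    {a | ∃ x y : F, x ≠ 0 ∧ x ≠ 1 ∧ y ≠ 0 ∧ y ≠ 1 ∧ x ≠ y ∧ a = FT x y}

/-- `FT⁺[x,y] = FT[-x, y+1] + 2c` in the pre-Bloch group, where `c = [w] + [1-w]`:
concretely, modulo five term relations,
`FT⁺[x,y] - FT[-x,y+1] = [w] + [1-w] + [w'] + [1-w']` for appropriate arguments. -/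
theorem stmt15 {F : Type*} [Field F] (x y : F)
    (hx0 : x ≠ 0) (hx1 : x ≠ 1) (hxm : x ≠ -1)
    (hy0 : y ≠ 0) (hy1 : y ≠ 1) (hym : y ≠ -1)
    (hs : x + y + 1 ≠ 0) :
    ∃ w w' : F, w ≠ 0 ∧ w ≠ 1 ∧ w' ≠ 0 ∧ w' ≠ 1 ∧
      FTplus x y - FT (-x) (y + 1)
          - (FreeAbelianGroup.of w + FreeAbelianGroup.of (1 - w)
              + FreeAbelianGroup.of w' + FreeAbelianGroup.of (1 - w')) ∈ FTsub F := by
  have hx1' : 1 + x ≠ 0 := fun h => hxm (by linear_combination h)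
  have hy1' : y + 1 ≠ 0 := fun h => hym (by linear_combination h)
  have hcompl : (1 - (-x)⁻¹) / (1 - (y + 1)⁻¹) = 1 - -(1 + x + y) / (x * y) := by
    have hd : 1 - (y + 1)⁻¹ = y / (y + 1) := by field_simp; ring
    rw [hd]
    field_simp
    ring
  refine ⟨-y, -(1 + x + y) / (x * y), neg_ne_zero.mpr hy0, ?_, ?_, ?_, ?_⟩
  · exact fun h => hym (by linear_combination -h)
  · exact div_ne_zero (neg_ne_zero.mpr fun h => hs (by linear_combination h))
      (mul_ne_zero hx0 hy0)
  · intro h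
    rw [div_eq_one_iff_eq (mul_ne_zero hx0 hy0)] at h
    exact mul_ne_zero hx1' hy1' (by linear_combination -h)
  · have hquot : (y + 1) / -x = -(1 + y) / x := by rw [div_neg, neg_div, add_comm]
    have hlast : (1 - -x) / (1 - (y + 1)) = -(1 + x) / y := by
      rw [show 1 - -x = 1 + x by ring, show 1 - (y + 1) = -y by ring, div_neg, neg_div]
    have hy : 1 - -y = y + 1 := by ring
    convert (FTsub F).zero_mem using 1
    rw [FTplus, FT, hcompl, hquot, hlast, hy]
    abel
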